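/- The family ℬ = (B_{x,L,𝒫}), indexed by x∈E, integers L≥1 and half-planes 𝒫, where B_{x,L,𝒫} = {σ ∈ {0,1}^E : B(x,L) is connected to ∂_int B(x,2L) by a *-path in 𝒫 on which σ takes the value 1} when x ∈ 𝒫, and B_{x,L,𝒫} = ∅ when x ∉ 𝒫, is a family of increasing events on {0,1}^E that cascades uniformly (in the parameter 𝒫) with complexity at most β/2. -/

import Mathlib

open MeasureTheory Filter Set
open scoped ENNReal NNReal Topology Classical

noncomputable section

/-- The weighted graph `G`: an infinite connected graph of bounded degree, with a weight
`ρG` which is uniformly bounded and uniformly positive on edges, `α`-Ahlfors regular. -/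
structure GraphSetup where
  V : Type
  infV : Infinite V
  adjG : V → V → Prop
  adjG_symm : ∀ {y y'}, adjG y y' → adjG y' y
  adjG_irrefl : ∀ y, ¬adjG y y
  /-- `dG` is the graph distance on `G`; this characterization also encodes connectedness. -/
  dG : V → V → ℕ
  dG_spec : ∀ (y y' : V) (n : ℕ), dG y y' ≤ n ↔
    ∃ p : ℕ → V, p 0 = y ∧ p n = y' ∧ ∀ i < n, p i = p (i + 1) ∨ adjG (p i) (p (i + 1))
  ballG_fin : ∀ (y : V) (R : ℝ), {y' | (dG y y' : ℝ) ≤ R}.Finite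
  degBound : ℕ
  deg_fin : ∀ y : V, {y' | adjG y y'}.Finite
  deg_le : ∀ y : V, Nat.card {y' // adjG y y'} ≤ degBound
  ρG : V → V → ℝ
  ρG_symm : ∀ y y', ρG y y' = ρG y' y
  ρG_nonneg : ∀ y y', 0 ≤ ρG y y'
  ρG_pos_iff : ∀ y y', 0 < ρG y y' ↔ adjG y y'
  ρG_lbd : ℝ
  ρG_ubd : ℝ
  ρG_lbd_pos : 0 < ρG_lbd
  ρG_bounds : ∀ y y', adjG y y' → ρG_lbd ≤ ρG y y' ∧ ρG y y' ≤ ρG_ubd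
  α : ℝ
  β : ℝ
  α_gt_one : 1 < α
  β_ge_two : 2 ≤ β
  β_le_α_add_one : β ≤ α + 1
  cA : ℝ
  cA' : ℝ
  cA_pos : 0 < cA
  /-- `α`-Ahlfors regularity of `(G, ρG)`, lower bound. -/
  ahlfors_lb : ∀ (y : V) (R : ℝ), 1 / 2 ≤ R →
    cA * R ^ α ≤ ∑ y' ∈ (ballG_fin y R).toFinset, ∑' y'', ρG y' y''
  /-- `α`-Ahlfors regularity of `(G, ρG)`, upper bound. -/
  ahlfors_ub : ∀ (y : V) (R : ℝ), 1 / 2 ≤ R →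
    (∑ y' ∈ (ballG_fin y R).toFinset, ∑' y'', ρG y' y'') ≤ cA' * R ^ α

namespace GraphSetup

/-- The product graph `E = G × ℤ`. -/
abbrev E (S : GraphSetup) : Type := S.V × ℤ

instance (S : GraphSetup) : MeasurableSpace S.V := ⊤

/-- The exponent `ν = α - β/2`. -/
def ν (S : GraphSetup) : ℝ := S.α - S.β / 2

/-- Adjacency on `E = G × ℤ`. -/
def adjE (S : GraphSetup) (x x' : S.E) : Prop :=
  (x.2 = x'.2 ∧ S.adjG x.1 x'.1) ∨ (x.1 = x'.1 ∧ (x.2 - x'.2).natAbs = 1)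

/-- The weight on `E`: `ρG` on horizontal edges, `1` on vertical edges. -/
def ρE (S : GraphSetup) (x x' : S.E) : ℝ :=
  if x.2 = x'.2 then S.ρG x.1 x'.1
  else if x.1 = x'.1 ∧ (x.2 - x'.2).natAbs = 1 then 1 else 0

/-- `ρ(x) = Σ_{x' ~ x} ρ_{x,x'}`. -/
def ρEpt (S : GraphSetup) (x : S.E) : ℝ := ∑' x', S.ρE x x'

/-- Transition probability of the walk on `E`. -/
def ptrans (S : GraphSetup) (x x' : S.E) : ℝ := S.ρE x x' / S.ρEpt x

/-- The metric `d((y,z),(y',z')) = max (d_G(y,y'), |z - z'|^{2/β})` on `E`. -/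
def dE (S : GraphSetup) (x x' : S.E) : ℝ :=
  max (S.dG x.1 x'.1 : ℝ) (|(x.2 : ℝ) - (x'.2 : ℝ)| ^ (2 / S.β))

/-- Closed `d`-ball in `E`. -/
def ball (S : GraphSetup) (x : S.E) (r : ℝ) : Set S.E := {x' | S.dE x x' ≤ r}

/-- Vertex boundary `∂U`. -/
def vBoundary (S : GraphSetup) (U : Set S.E) : Set S.E :=
  {x | x ∉ U ∧ ∃ x' ∈ U, S.adjE x x'}

/-- Closure `U ∪ ∂U`. -/
def cl (S : GraphSetup) (U : Set S.E) : Set S.E := U ∪ S.vBoundary U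

/-- Interior vertex boundary `∂_int U`. -/
def intBoundary (S : GraphSetup) (U : Set S.E) : Set S.E :=
  {x | x ∈ U ∧ ∃ x', x' ∉ U ∧ S.adjE x x'}

/-- A nearest-neighbour path of length `n` contained in `A`. -/
def IsPathIn (S : GraphSetup) (A : Set S.E) (p : ℕ → S.E) (n : ℕ) : Prop :=
  (∀ i ≤ n, p i ∈ A) ∧ ∀ i < n, S.adjE (p i) (p (i + 1))

/-- `B₁` is connected to `B₂` by a nearest-neighbour path contained in `A`. -/
def ConnectsIn (S : GraphSetup) (A B₁ B₂ : Set S.E) : Prop :=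
  ∃ (n : ℕ) (p : ℕ → S.E), S.IsPathIn A p n ∧ p 0 ∈ B₁ ∧ p n ∈ B₂

/-- The connected component of `x` inside `A`. -/
def component (S : GraphSetup) (A : Set S.E) (x : S.E) : Set S.E :=
  {x' | S.ConnectsIn A {x} {x'}}

/-- `A` is a connected subset of `E`. -/
def IsConnectedSet (S : GraphSetup) (A : Set S.E) : Prop :=
  ∀ x ∈ A, ∀ x' ∈ A, S.ConnectsIn A {x} {x'}

/-- `C` separates `A` and `B` in `U`: the graph distance between `A` and `B` exceeds `1`
and every nearest-neighbour path from `∂A` to `∂B` remaining in `U` meets `C`. -/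
def Separates (S : GraphSetup) (A B C U : Set S.E) : Prop :=
  (∀ a ∈ A, ∀ b ∈ B, a ≠ b ∧ ¬S.adjE a b) ∧
  ∀ (n : ℕ) (p : ℕ → S.E), (∀ i ≤ n, p i ∈ U) → (∀ i < n, S.adjE (p i) (p (i + 1))) →
    p 0 ∈ S.vBoundary A → p n ∈ S.vBoundary B → ∃ i ≤ n, p i ∈ C

/-- The separation event `S_{x,L}`. -/
def sepEvent (S : GraphSetup) (x : S.E) (L : ℕ) : Set (Set S.E) :=
  {C | ∃ A₁ A₂ : Set S.E,
    A₁ ⊆ S.cl (S.ball x (3 * L)) ∧ A₂ ⊆ S.cl (S.ball x (3 * L)) ∧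
    S.IsConnectedSet A₁ ∧ S.IsConnectedSet A₂ ∧
    (∃ a ∈ A₁, ∃ a' ∈ A₁, (L : ℝ) ≤ S.dE a a') ∧
    (∃ a ∈ A₂, ∃ a' ∈ A₂, (L : ℝ) ≤ S.dE a a') ∧
    S.Separates A₁ A₂ C (S.ball x (5 * L))}

/-- A half-plane of `E = G × ℤ`: the product of a semi-infinite geodesic in `G` with `ℤ`. -/
structure HalfPlane (S : GraphSetup) where
  ray : ℕ → S.V
  geodesic : ∀ n m : ℕ, S.dG (ray n) (ray m) = Nat.dist n m

/-- The set of points of a half-plane. -/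
def HalfPlane.carrier {S : GraphSetup} (P : S.HalfPlane) : Set S.E :=
  {x | ∃ n, x.1 = P.ray n}

/-- `B₁` is connected to `B₂` by a `*`-path contained in `A ∩ 𝒫`. -/
def StarConnectsIn (S : GraphSetup) (P : S.HalfPlane) (A B₁ B₂ : Set S.E) : Prop :=
  ∃ (n : ℕ) (p : ℕ → S.E),
    (∀ i ≤ n, p i ∈ A ∧ p i ∈ P.carrier) ∧
    (∀ i < n, p i ≠ p (i + 1) ∧ S.dG (p i).1 (p (i + 1)).1 ≤ 1 ∧
      ((p i).2 - (p (i + 1)).2).natAbs ≤ 1) ∧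
    p 0 ∈ B₁ ∧ p n ∈ B₂

/-- An increasing event on `{0,1}^E` (configurations identified with subsets of `E`). -/
def IncreasingEvent (S : GraphSetup) (A : Set (Set S.E)) : Prop :=
  ∀ C C' : Set S.E, C ⊆ C' → C ∈ A → C' ∈ A

/-- A decreasing event on `{0,1}^E`. -/
def DecreasingEvent (S : GraphSetup) (A : Set (Set S.E)) : Prop :=
  ∀ C C' : Set S.E, C' ⊆ C → C ∈ A → C' ∈ A

/-- The event `A` only depends on the coordinates in `B`. -/
def DependsOn (S : GraphSetup) (A : Set (Set S.E)) (B : Set S.E) : Prop :=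
  ∀ C C' : Set S.E, C ∩ B = C' ∩ B → (C ∈ A ↔ C' ∈ A)

/-- The family `(G_{x,L})` cascades with complexity at most `lam`, with constant `c`. -/
def CascadesLe (S : GraphSetup) (Gf : S.E → ℕ → Set (Set S.E)) (lam c : ℝ) : Prop :=
  (∀ (x : S.E) (L : ℕ), 1 ≤ L → S.DependsOn (Gf x L) (S.ball x (10 * L))) ∧
  ∀ (ℓ : ℕ) (x : S.E) (L : ℕ), 1 ≤ L → 0 < ℓ → 100 ∣ ℓ →
    ∃ Λ : Finset S.E, ↑Λ ⊆ S.ball x (9 * ℓ * L) ∧ (Λ.card : ℝ) ≤ c * (ℓ : ℝ) ^ lam ∧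
      Gf x (ℓ * L) ⊆
        ⋃ x' ∈ Λ, ⋃ x'' ∈ Λ,
          ⋃ (_ : ((ℓ * L : ℕ) : ℝ) / 100 ≤ S.dE x' x''), Gf x' L ∩ Gf x'' L

/-- The length scales `L_n = ℓ₀ⁿ L₀`. -/
def Lscale (ℓ₀ L₀ n : ℕ) : ℕ := ℓ₀ ^ n * L₀

/-- Membership in `Λ_n`: an embedding of the dyadic tree of depth `n` in `E`,
with nested balls and spread-out children. -/
def IsTreeEmbed (S : GraphSetup) (ℓ₀ L₀ n : ℕ) (T : ∀ k : ℕ, (Fin k → Bool) → S.E) : Prop :=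
  ∀ k < n, ∀ (m : Fin k → Bool) (b : Bool),
    S.ball (T (k + 1) (Fin.snoc m b)) (10 * Lscale ℓ₀ L₀ (n - (k + 1))) ⊆
        S.ball (T k m) (10 * Lscale ℓ₀ L₀ (n - k)) ∧
      ((Lscale ℓ₀ L₀ (n - k) : ℝ)) / 100 ≤
        S.dE (T (k + 1) (Fin.snoc m false)) (T (k + 1) (Fin.snoc m true))

/-- The factor `1 + c₁ √K (k+1)^{-3/2} ℓ₀^{-(ν-ν')/2}`. -/
def decFactor (c₁ K νv ν' : ℝ) (ℓ₀ : ℕ) (k : ℕ) : ℝ :=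
  1 + c₁ * Real.sqrt K * ((k : ℝ) + 1) ^ (-(3 : ℝ) / 2) * (ℓ₀ : ℝ) ^ (-(νv - ν') / 2)

/-- The increasing sequence of levels `u_n⁺`. -/
def uPlusSeq (c₁ K νv ν' : ℝ) (ℓ₀ : ℕ) (u₀ : ℝ) (n : ℕ) : ℝ :=
  (∏ k ∈ Finset.range n, decFactor c₁ K νv ν' ℓ₀ k) * u₀

/-- The decreasing sequence of levels `u_n⁻`. -/
def uMinusSeq (c₁ K νv ν' : ℝ) (ℓ₀ : ℕ) (u₀ : ℝ) (n : ℕ) : ℝ :=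
  (∏ k ∈ Finset.range n, (decFactor c₁ K νv ν' ℓ₀ k)⁻¹) * u₀

/-- The limit `u_∞⁺` of `u_n⁺`. -/
def uPlusInf (c₁ K νv ν' : ℝ) (ℓ₀ : ℕ) (u₀ : ℝ) : ℝ := ⨆ n, uPlusSeq c₁ K νv ν' ℓ₀ u₀ n

/-- The limit `u_∞⁻` of `u_n⁻`. -/
def uMinusInf (c₁ K νv ν' : ℝ) (ℓ₀ : ℕ) (u₀ : ℝ) : ℝ := ⨅ n, uMinusSeq c₁ K νv ν' ℓ₀ u₀ n

/-- The error term `ε(u) = 2 e^{-K u L₀^ν ℓ₀^{ν'}} / (1 - e^{-K u L₀^ν ℓ₀^{ν'}})`. -/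
def epsDecouple (K u : ℝ) (L₀ ℓ₀ : ℕ) (νv ν' : ℝ) : ℝ :=
  2 * Real.exp (-(K * u * (L₀ : ℝ) ^ νv * (ℓ₀ : ℝ) ^ ν')) /
    (1 - Real.exp (-(K * u * (L₀ : ℝ) ^ νv * (ℓ₀ : ℝ) ^ ν')))

/-- The canonical law of the random walk on `E`, as a family of measures on trajectories. -/
structure WalkLaw (S : GraphSetup) where
  P : S.E → Measure (ℕ → S.E)
  isProb : ∀ x, IsProbabilityMeasure (P x)
  cyl : ∀ (x : S.E) (n : ℕ) (q : ℕ → S.E), q 0 = x →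
    P x {w | ∀ i ≤ n, w i = q i} =
      ENNReal.ofReal (∏ i ∈ Finset.range n, S.ptrans (q i) (q (i + 1)))
  cyl0 : ∀ (x : S.E) (q : ℕ → S.E), q 0 ≠ x → P x {w | w 0 = q 0} = 0

instance {S : GraphSetup} (W : WalkLaw S) (x : S.E) : IsProbabilityMeasure (W.P x) :=
  W.isProb x

namespace WalkLaw

variable {S : GraphSetup}

/-- `P_x[H_K < ∞]`, the probability to ever enter `K`. -/
def hitProb (W : WalkLaw S) (x : S.E) (K : Set S.E) : ℝ≥0∞ := W.P x {w | ∃ n, w n ∈ K}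

/-- `P_x[H̃_K = ∞]`, the probability never to hit `K` at a positive time. -/
def escProb (W : WalkLaw S) (x : S.E) (K : Set S.E) : ℝ≥0∞ :=
  W.P x {w | ∀ n, 1 ≤ n → w n ∉ K}

/-- `P_x[H_K < ∞, X_{H_K} = x']`, the probability to enter `K` for the first time at `x'`. -/
def entersAt (W : WalkLaw S) (x : S.E) (K : Set S.E) (x' : S.E) : ℝ≥0∞ :=
  W.P x {w | ∃ n, w n = x' ∧ ∀ m < n, w m ∉ K}

/-- The equilibrium measure `e_K`. -/
def equilibrium (W : WalkLaw S) (K : Set S.E) (x : S.E) : ℝ :=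
  if x ∈ K then (W.escProb x K).toReal * S.ρEpt x else 0

/-- The capacity `cap(K) = Σ_{x ∈ K} P_x[H̃_K = ∞] ρ(x)`. -/
def capacity (W : WalkLaw S) (K : Set S.E) : ℝ :=
  ∑' x : K, (W.escProb x.1 K).toReal * S.ρEpt x.1

/-- The Green density `g(x,x') = Σ_{n ≥ 0} P_x[X_n = x'] / ρ(x')`. -/
def green (W : WalkLaw S) (x x' : S.E) : ℝ :=
  (∑' n : ℕ, (W.P x {w | w n = x'}).toReal) / S.ρEpt x'

/-- The standing assumption `c (d(x,x') ∨ 1)^{-ν} ≤ g(x,x') ≤ c' (d(x,x') ∨ 1)^{-ν}`. -/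
def GreenBounds (W : WalkLaw S) (cg cg' : ℝ) : Prop :=
  0 < cg ∧ cg ≤ cg' ∧ ∀ x x' : S.E,
    cg * (max (S.dE x x') 1) ^ (-S.ν) ≤ W.green x x' ∧
      W.green x x' ≤ cg' * (max (S.dE x x') 1) ^ (-S.ν)

end WalkLaw

/-- Random interlacements on `E`, encoded by their canonical probability space and the
family of interlacement sets `ℐ^u`, `u ≥ 0`, with
`ℙ[𝒱^u ⊇ K] = exp(-u cap(K))` for all finite `K`. -/
structure Interlacement (S : GraphSetup) (W : WalkLaw S) where
  Ω : Type
  mΩ : MeasurableSpace Ω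
  prob : @Measure Ω mΩ
  isProb : IsProbabilityMeasure prob
  I : ℝ → Ω → Set S.E
  I_mono : ∀ u u' : ℝ, u ≤ u' → ∀ ω, I u ω ⊆ I u' ω
  vacant_law : ∀ u : ℝ, 0 ≤ u → ∀ K : Set S.E, K.Finite →
    prob {ω | Disjoint K (I u ω)} = ENNReal.ofReal (Real.exp (-(u * W.capacity K)))

namespace Interlacement

variable {S : GraphSetup} {W : WalkLaw S}

/-- The vacant set `𝒱^u = E ∖ ℐ^u`. -/
def vacant (RI : Interlacement S W) (u : ℝ) (ω : RI.Ω) : Set S.E := (RI.I u ω)ᶜ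

/-- The event that `x` lies in an infinite connected component of `𝒱^u`. -/
def percolates (RI : Interlacement S W) (x : S.E) (u : ℝ) : Set RI.Ω :=
  {ω | (S.component (RI.vacant u ω) x).Infinite}

/-- The one-arm event: `B(x,L)` is connected to `∂_int B(x,2L)` in `𝒱^u`. -/
def oneArm (RI : Interlacement S W) (x : S.E) (L : ℝ) (u : ℝ) : Set RI.Ω :=
  {ω | S.ConnectsIn (RI.vacant u ω) (S.ball x L) (S.intBoundary (S.ball x (2 * L)))}

/-- `sup_{x ∈ E} ℙ[B(x,L) ↔ ∂_int B(x,2L) in 𝒱^u]`. -/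
def oneArmSup (RI : Interlacement S W) (u : ℝ) (L : ℕ) : ℝ≥0∞ :=
  ⨆ x : S.E, RI.prob (RI.oneArm x L u)

/-- The set defining `u_*`. -/
def uStarSet (RI : Interlacement S W) : Set ℝ :=
  {u | 0 ≤ u ∧ ∀ x : S.E, RI.prob (RI.percolates x u) = 0}

/-- The critical level `u_*`. -/
def uStar (RI : Interlacement S W) : ℝ := sInf RI.uStarSet

/-- The set defining `u_**`. -/
def uStarStarSet (RI : Interlacement S W) : Set ℝ :=
  {u | 0 ≤ u ∧ Filter.liminf (fun L : ℕ => RI.oneArmSup u L) Filter.atTop = 0}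

/-- The critical level `u_**`. -/
def uStarStar (RI : Interlacement S W) : ℝ := sInf RI.uStarStarSet

/-- The `*`-crossing event for `ℐ^u` inside a half-plane. -/
def starCross (RI : Interlacement S W) (P : S.HalfPlane) (x : S.E) (L : ℝ) (u : ℝ) :
    Set RI.Ω :=
  {ω | S.StarConnectsIn P (RI.I u ω) (S.ball x L) (S.intBoundary (S.ball x (2 * L)))}

/-- `sup_{𝒫, x ∈ 𝒫} ℙ[B(x,L) ↔* ∂_int B(x,2L) in ℐ^u ∩ 𝒫]`. -/
def starSup (RI : Interlacement S W) (u : ℝ) (L : ℕ) : ℝ≥0∞ :=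
  ⨆ P : S.HalfPlane, ⨆ x : P.carrier, RI.prob (RI.starCross P x.1 L u)

/-- The set defining `ũ`. -/
def uTildeSet (RI : Interlacement S W) : Set ℝ :=
  {u | 0 ≤ u ∧ 0 < Filter.liminf (fun L : ℕ => RI.starSup u L) Filter.atTop}

/-- The critical level `ũ`. -/
def uTilde (RI : Interlacement S W) : ℝ := sInf RI.uTildeSet

/-- For an event `A` on `{0,1}^E`, the event `A^u` that the indicator of `ℐ^u` lies in `A`. -/
def eventAt (RI : Interlacement S W) (A : Set (Set S.E)) (u : ℝ) : Set RI.Ω :=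
  {ω | RI.I u ω ∈ A}

end Interlacement

end GraphSetup

namespace GraphSetup

section Metric

variable (S : GraphSetup)

lemma dG_self (y : S.V) : S.dG y y = 0 :=
  Nat.le_zero.1 ((S.dG_spec y y 0).2 ⟨fun _ => y, rfl, rfl, by simp⟩)

lemma dG_comm_le (y y' : S.V) : S.dG y' y ≤ S.dG y y' := by
  obtain ⟨p, h0, hn, hp⟩ := (S.dG_spec y y' _).1 le_rfl
  refine (S.dG_spec y' y _).2 ⟨fun i => p (S.dG y y' - i), by simpa using hn, by simpa using h0,
    fun i hi => ?_⟩
  have hs : S.dG y y' - i = S.dG y y' - (i + 1) + 1 := by omega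
  have h := hp (S.dG y y' - (i + 1)) (by omega)
  rw [← hs] at h
  exact h.imp Eq.symm (fun h => S.adjG_symm h)

lemma dG_comm (y y' : S.V) : S.dG y y' = S.dG y' y :=
  le_antisymm (S.dG_comm_le y' y) (S.dG_comm_le y y')

lemma dG_triangle (a b c : S.V) : S.dG a c ≤ S.dG a b + S.dG b c := by
  obtain ⟨p, p0, pn, hp⟩ := (S.dG_spec a b _).1 le_rfl
  obtain ⟨q, q0, qn, hq⟩ := (S.dG_spec b c _).1 le_rfl
  refine (S.dG_spec a c _).2
    ⟨fun i => if i ≤ S.dG a b then p i else q (i - S.dG a b), by simpa using p0, ?_, fun i hi => ?_⟩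
  · by_cases h : S.dG b c = 0
    · rw [h] at qn
      obtain rfl : b = c := q0.symm.trans qn
      simp [S.dG_self, pn]
    · have h' : ¬ S.dG a b + S.dG b c ≤ S.dG a b := by omega
      simpa [h'] using qn
  · rcases lt_trichotomy i (S.dG a b) with h | h | h
    · simpa [h.le, Nat.succ_le_of_lt h] using hp i h
    · subst h
      simpa [pn, q0] using hq 0 (by omega)
    · have h1 : ¬ i ≤ S.dG a b := by omega
      have h2 : ¬ i + 1 ≤ S.dG a b := by omega
      have h3 : i + 1 - S.dG a b = i - S.dG a b + 1 := by omega
      simpa [h1, h2, h3] using hq (i - S.dG a b) (by omega)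

lemma adjG_of_dG_le_one {y y' : S.V} (h : S.dG y y' ≤ 1) (hne : y ≠ y') : S.adjG y y' := by
  obtain ⟨p, p0, p1, hp⟩ := (S.dG_spec y y' 1).1 h
  have h01 := hp 0 one_pos
  simp only [zero_add, p0, p1] at h01
  exact h01.resolve_left hne

lemma dG_le_one_of_adjG {y y' : S.V} (h : S.adjG y y') : S.dG y y' ≤ 1 :=
  (S.dG_spec y y' 1).2
    ⟨fun i => if i = 0 then y else y', by simp, by simp, fun i hi => by
      obtain rfl : i = 0 := by omega
      simpa using Or.inr h⟩

lemma β_pos : 0 < S.β := by linarith [S.β_ge_two]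

lemma dE_comm (x y : S.E) : S.dE x y = S.dE y x := by
  simp only [dE, S.dG_comm x.1 y.1, abs_sub_comm (x.2 : ℝ) (y.2 : ℝ)]

lemma dE_triangle (a b c : S.E) : S.dE a c ≤ S.dE a b + S.dE b c := by
  have hβ := S.β_ge_two
  have hs0 : 0 ≤ 2 / S.β := by have := S.β_pos; positivity
  have hs1 : 2 / S.β ≤ 1 := (div_le_one S.β_pos).2 hβ
  unfold dE
  refine max_le ?_ ?_
  · calc (S.dG a.1 c.1 : ℝ) ≤ (S.dG a.1 b.1 : ℝ) + S.dG b.1 c.1 := by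
          exact_mod_cast S.dG_triangle a.1 b.1 c.1
      _ ≤ _ := add_le_add (le_max_left _ _) (le_max_left _ _)
  · calc |(a.2 : ℝ) - c.2| ^ (2 / S.β) ≤ (|(a.2 : ℝ) - b.2| + |(b.2 : ℝ) - c.2|) ^ (2 / S.β) :=
          Real.rpow_le_rpow (abs_nonneg _) (abs_sub_le _ _ _) hs0
      _ ≤ |(a.2 : ℝ) - b.2| ^ (2 / S.β) + |(b.2 : ℝ) - c.2| ^ (2 / S.β) :=
          Real.rpow_add_le_add_rpow (abs_nonneg _) (abs_nonneg _) hs0 hs1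
      _ ≤ _ := add_le_add (le_max_right _ _) (le_max_right _ _)

lemma mem_ball_iff {x y : S.E} {r : ℝ} (hr : 0 ≤ r) :
    y ∈ S.ball x r ↔
      (S.dG x.1 y.1 : ℝ) ≤ r ∧ (x.2 - y.2).natAbs ≤ ⌊r ^ (S.β / 2)⌋₊ := by
  have hβ := S.β_pos
  have h2 : 2 / S.β = (S.β / 2)⁻¹ := by rw [inv_div]
  have habs : |(x.2 : ℝ) - y.2| = ((x.2 - y.2).natAbs : ℝ) := by
    rw [Nat.cast_natAbs]; push_cast; rfl
  simp only [ball, dE, mem_ofPred_eq, max_le_iff, h2]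
  rw [Real.rpow_inv_le_iff_of_pos (abs_nonneg _) hr (by positivity), habs,
    Nat.le_floor_iff (by positivity)]

lemma dE_le_one {x y : S.E} (h₁ : S.dG x.1 y.1 ≤ 1) (h₂ : (x.2 - y.2).natAbs ≤ 1) :
    S.dE x y ≤ 1 :=
  (S.mem_ball_iff (r := 1) zero_le_one).2 ⟨by exact_mod_cast h₁, by simpa using h₂⟩

lemma dE_le_one_of_adjE {x y : S.E} (h : S.adjE x y) : S.dE x y ≤ 1 := by
  rcases h with ⟨h₁, h₂⟩ | ⟨h₁, h₂⟩
  · exact S.dE_le_one (S.dG_le_one_of_adjG h₂) (by simp [h₁])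
  · exact S.dE_le_one (by simp [h₁, S.dG_self]) h₂.le

lemma lt_dE_add_one_of_mem_intBoundary {x y : S.E} {r : ℝ}
    (h : y ∈ S.intBoundary (S.ball x r)) : r < S.dE x y + 1 := by
  obtain ⟨-, y', hy', hadj⟩ := h
  have h1 : r < S.dE x y' := not_le.1 hy'
  linarith [S.dE_triangle x y y', S.dE_le_one_of_adjE hadj]

/-- A `*`-step leaving a ball starts on the interior boundary of that ball. -/
lemma mem_intBoundary_of_star_step {x u v : S.E} {r : ℝ} (hr : 0 ≤ r)
    (hu : u ∈ S.ball x r) (hv : v ∉ S.ball x r) (h₁ : S.dG u.1 v.1 ≤ 1)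
    (h₂ : (u.2 - v.2).natAbs ≤ 1) : u ∈ S.intBoundary (S.ball x r) := by
  refine ⟨hu, ?_⟩
  rw [S.mem_ball_iff hr] at hu hv
  by_cases hG : (S.dG x.1 v.1 : ℝ) ≤ r
  · have hz : ¬ (x.2 - v.2).natAbs ≤ ⌊r ^ (S.β / 2)⌋₊ := fun h => hv ⟨hG, h⟩
    refine ⟨(u.1, v.2), fun h => hz ((S.mem_ball_iff hr).1 h).2, Or.inr ⟨rfl, ?_⟩⟩
    show (u.2 - v.2).natAbs = 1
    omega
  · refine ⟨(v.1, u.2), fun h => hG ((S.mem_ball_iff hr).1 h).1, Or.inl ⟨rfl, ?_⟩⟩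
    refine S.adjG_of_dG_le_one h₁ fun h => hG ?_
    rw [← h]
    exact hu.1

end Metric

/-- First exit from a set along a sequence. -/
lemma exists_first_exit {α : Type*} {A : Set α} {p : ℕ → α} {N : ℕ} (h0 : p 0 ∈ A)
    (hN : p N ∉ A) : ∃ i < N, (∀ j ≤ i, p j ∈ A) ∧ p (i + 1) ∉ A := by
  have hex : ∃ n, p n ∉ A := ⟨N, hN⟩
  have hpos : Nat.find hex ≠ 0 := fun h => (h ▸ Nat.find_spec hex) h0
  obtain ⟨i, hi⟩ := Nat.exists_eq_succ_of_ne_zero hpos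
  refine ⟨i, ?_, fun j hj => ?_, ?_⟩
  · have := Nat.find_min' hex hN
    omega
  · by_contra h
    have := Nat.find_min' hex h
    omega
  · have := Nat.find_spec hex
    rwa [hi] at this

/-- A `*`-path from `B(y,r)` which leaves `B(y,2r)` contains a `*`-crossing inside `B(y,2r)`. -/
lemma starConnectsIn_of_exit (S : GraphSetup) (P : S.HalfPlane) {C : Set S.E} {y : S.E} {r : ℝ}
    (hr : 0 ≤ r) {n : ℕ} {p : ℕ → S.E} (hp : ∀ i ≤ n, p i ∈ C ∧ p i ∈ P.carrier)
    (hstep : ∀ i < n, p i ≠ p (i + 1) ∧ S.dG (p i).1 (p (i + 1)).1 ≤ 1 ∧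
      ((p i).2 - (p (i + 1)).2).natAbs ≤ 1)
    (h0 : p 0 ∈ S.ball y r) (hn : p n ∉ S.ball y (2 * r)) :
    S.StarConnectsIn P (C ∩ S.ball y (2 * r)) (S.ball y r) (S.intBoundary (S.ball y (2 * r))) := by
  have h0' : p 0 ∈ S.ball y (2 * r) := le_trans (show S.dE y (p 0) ≤ r from h0) (by linarith)
  obtain ⟨i, hi, hin, hout⟩ := exists_first_exit h0' hn
  exact ⟨i, p, fun j hj => ⟨⟨(hp j (by omega)).1, hin j hj⟩, (hp j (by omega)).2⟩,
    fun j hj => hstep j (by omega), h0,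
    S.mem_intBoundary_of_star_step (by linarith) (hin i le_rfl) hout (hstep i hi).2.1
      (hstep i hi).2.2⟩

lemma StarConnectsIn.mono {S : GraphSetup} {P : S.HalfPlane} {A A' B₁ B₂ : Set S.E} (hA : A ⊆ A')
    (h : S.StarConnectsIn P A B₁ B₂) : S.StarConnectsIn P A' B₁ B₂ := by
  obtain ⟨n, p, hp, hrest⟩ := h
  exact ⟨n, p, fun i hi => ⟨hA (hp i hi).1, (hp i hi).2⟩, hrest⟩

/-- A `*`-crossing can be localized inside `B(y,2r)`. -/
lemma StarConnectsIn.inter_ball {S : GraphSetup} {P : S.HalfPlane} {C : Set S.E} {y : S.E} {r : ℝ}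
    (hr : 0 ≤ r)
    (h : S.StarConnectsIn P C (S.ball y r) (S.intBoundary (S.ball y (2 * r)))) :
    S.StarConnectsIn P (C ∩ S.ball y (2 * r)) (S.ball y r)
      (S.intBoundary (S.ball y (2 * r))) := by
  obtain ⟨n, p, hp, hstep, h0, hn⟩ := h
  by_cases hall : ∀ i ≤ n, p i ∈ S.ball y (2 * r)
  · exact ⟨n, p, fun i hi => ⟨⟨(hp i hi).1, hall i hi⟩, (hp i hi).2⟩, hstep, h0, hn⟩
  · push Not at hall
    obtain ⟨i, hi, hout⟩ := hall
    exact S.starConnectsIn_of_exit P hr (fun j hj => hp j (by omega))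
      (fun j hj => hstep j (by omega)) h0 hout

lemma dependsOn_starCrossing (S : GraphSetup) (P : S.HalfPlane) (x : S.E) (L : ℕ) :
    S.DependsOn {C : Set S.E | x ∈ P.carrier ∧
      S.StarConnectsIn P C (S.ball x L) (S.intBoundary (S.ball x (2 * L)))}
      (S.ball x (10 * L)) := by
  have key : ∀ C C' : Set S.E, C ∩ S.ball x (10 * L) = C' ∩ S.ball x (10 * L) →
      S.StarConnectsIn P C (S.ball x L) (S.intBoundary (S.ball x (2 * L))) →
      S.StarConnectsIn P C' (S.ball x L) (S.intBoundary (S.ball x (2 * L))) := by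
    intro C C' hCC h
    refine (h.inter_ball (Nat.cast_nonneg L)).mono fun w hw => ?_
    have hw' : w ∈ C ∩ S.ball x (10 * L) := by
      refine ⟨hw.1, le_trans (show S.dE x w ≤ 2 * L from hw.2) ?_⟩
      have : (0 : ℝ) ≤ L := Nat.cast_nonneg L
      linarith
    rw [hCC] at hw'
    exact hw'.1
  exact fun C C' h => and_congr_right fun _ => ⟨key C C' h, key C' C h.symm⟩

/-- The interval of quotients by `h` of integers at distance at most `Z` from `z` is small. -/
lemma card_Icc_ediv_le {h : ℤ} (hh : 0 < h) (z Z : ℤ) (hZ : 0 ≤ Z) :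
    ((Finset.Icc ((z - Z) / h) ((z + Z) / h)).card : ℝ) ≤ 2 * (Z / h : ℝ) + 2 := by
  have hh' : (0 : ℝ) < h := by exact_mod_cast hh
  have h1 : (((z + Z) / h : ℤ) : ℝ) ≤ ((z + Z : ℤ) : ℝ) / h := by
    rw [le_div_iff₀ hh']
    exact_mod_cast Int.ediv_mul_le _ hh.ne'
  have h2 : ((z - Z : ℤ) : ℝ) / h < (((z - Z) / h : ℤ) : ℝ) + 1 := by
    rw [div_lt_iff₀ hh']
    exact_mod_cast Int.lt_ediv_add_one_mul_self _ hh
  have h3 : (z - Z) / h ≤ (z + Z) / h + 1 := by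
    have := Int.ediv_le_ediv hh (show z - Z ≤ z + Z by omega)
    omega
  rw [Int.card_Icc]
  have h4 : (((z + Z) / h + 1 - (z - Z) / h).toNat : ℝ)
      = (((z + Z) / h : ℤ) : ℝ) + 1 - (((z - Z) / h : ℤ) : ℝ) := by
    rw [← Int.cast_natCast, Int.toNat_of_nonneg (by omega)]
    push_cast
    rfl
  rw [h4]
  push_cast at h1 h2 ⊢
  have h5 : ((z : ℝ) + Z) / h = (z - Z) / h + 2 * (Z / h) := by ring
  linarith

/-- A net of mesh `L` of the shell of radius `R` in a half-plane: each point of the half-plane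
reached by a `*`-step out of `B(x,R)` is at distance at most `L` from the net. -/
lemma exists_shell_net (S : GraphSetup) (P : S.HalfPlane) {x : S.E} (hx : x ∈ P.carrier)
    {L l R : ℕ} (hL : 1 ≤ L) (hl : 1 ≤ l) (hR1 : 1 ≤ R) (hR : R ≤ 2 * l * L) :
    ∃ T : Finset S.E,
      (T.card : ℝ) ≤ (16 * 2 ^ (S.β / 2) + 20) * (l : ℝ) ^ (S.β / 2) ∧
      ∀ u v : S.E, u ∈ S.ball x R → v ∉ S.ball x R → v ∈ P.carrier → S.dG u.1 v.1 ≤ 1 →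
        (u.2 - v.2).natAbs ≤ 1 → ∃ x' ∈ T, x' ∈ P.carrier ∧ S.dE x' v ≤ L := by
  obtain ⟨n₀, hn₀⟩ := hx
  have hβ := S.β_ge_two
  have hb : 1 ≤ S.β / 2 := by linarith
  have hL' : (1 : ℝ) ≤ L := by exact_mod_cast hL
  have hl' : (1 : ℝ) ≤ l := by exact_mod_cast hl
  have hR1' : (1 : ℝ) ≤ R := by exact_mod_cast hR1
  set b := S.β / 2 with hbdef
  obtain ⟨h, hh⟩ : ∃ h : ℕ, h = ⌊(L : ℝ) ^ b⌋₊ := ⟨_, rfl⟩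
  obtain ⟨Z, hZ⟩ : ∃ Z : ℕ, Z = ⌊(R : ℝ) ^ b⌋₊ := ⟨_, rfl⟩
  have hLb : 1 ≤ (L : ℝ) ^ b := Real.one_le_rpow hL' (by linarith)
  have hRb : 1 ≤ (R : ℝ) ^ b := Real.one_le_rpow hR1' (by linarith)
  have hlb : (l : ℝ) ≤ (l : ℝ) ^ b := by
    simpa using Real.rpow_le_rpow_of_exponent_le hl' hb
  have hh1 : 1 ≤ h := by rw [hh]; exact Nat.le_floor (by simpa using hLb)
  have hh1' : (1 : ℝ) ≤ h := by exact_mod_cast hh1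
  have hLh : (L : ℝ) ^ b ≤ 2 * h := by
    have := Nat.lt_floor_add_one ((L : ℝ) ^ b)
    rw [← hh] at this
    linarith
  have hZR : (Z : ℝ) ≤ (R : ℝ) ^ b := by rw [hZ]; exact Nat.floor_le (by positivity)
  have hRl : (R : ℝ) ≤ 2 * l * L := by exact_mod_cast hR
  have hZh : ((Z : ℝ) + 1) / h ≤ 4 * 2 ^ b * (l : ℝ) ^ b := by
    rw [div_le_iff₀ (by linarith)]
    calc (Z : ℝ) + 1 ≤ 2 * (R : ℝ) ^ b := by linarith
      _ ≤ 2 * (2 * l * L : ℝ) ^ b := by gcongr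
      _ = 2 * 2 ^ b * (l : ℝ) ^ b * (L : ℝ) ^ b := by
          rw [Real.mul_rpow (by positivity) (by positivity),
            Real.mul_rpow (by positivity) (by positivity)]
          ring
      _ ≤ 2 * 2 ^ b * (l : ℝ) ^ b * (2 * h) := by gcongr
      _ = _ := by ring
  have hNL : ((R : ℝ) + 1) / L ≤ 3 * (l : ℝ) ^ b := by
    rw [div_le_iff₀ (by linarith)]
    nlinarith [mul_le_mul hl' hL' zero_le_one (by linarith)]
  set IA := Finset.Icc (((n₀ : ℤ) - ((R : ℤ) + 1)) / (L : ℤ)) (((n₀ : ℤ) + ((R : ℤ) + 1)) / (L : ℤ))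
  set IB := Finset.Icc ((x.2 - ((Z : ℤ) + 1)) / (h : ℤ)) ((x.2 + ((Z : ℤ) + 1)) / (h : ℤ))
  set EA : Finset ℤ :=
    {((n₀ : ℤ) - ((R : ℤ) + 1)) / (L : ℤ), ((n₀ : ℤ) + ((R : ℤ) + 1)) / (L : ℤ)}
  set EB : Finset ℤ :=
    {(x.2 - ((Z : ℤ) + 1)) / (h : ℤ), (x.2 + ((Z : ℤ) + 1)) / (h : ℤ)}
  have hIA : (IA.card : ℝ) ≤ 2 * (((R : ℝ) + 1) / L) + 2 := by
    simpa [-Int.card_Icc] using card_Icc_ediv_le (show (0 : ℤ) < L by omega) (n₀ : ℤ) ((R : ℤ) + 1) (by omega)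
  have hIB : (IB.card : ℝ) ≤ 2 * (((Z : ℝ) + 1) / h) + 2 := by
    simpa [-Int.card_Icc] using card_Icc_ediv_le (show (0 : ℤ) < h by omega) x.2 ((Z : ℤ) + 1) (by omega)
  have hEA : (EA.card : ℝ) ≤ 2 := by exact_mod_cast Finset.card_le_two
  have hEB : (EB.card : ℝ) ≤ 2 := by exact_mod_cast Finset.card_le_two
  refine ⟨(EA ×ˢ IB ∪ IA ×ˢ EB).image
    fun q : ℤ × ℤ => ((P.ray ((L : ℤ) * q.1).toNat, (h : ℤ) * q.2) : S.E), ?_, ?_⟩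
  · have hcard : (((EA ×ˢ IB ∪ IA ×ˢ EB).image
        fun q : ℤ × ℤ => ((P.ray ((L : ℤ) * q.1).toNat, (h : ℤ) * q.2) : S.E)).card : ℝ)
          ≤ EA.card * IB.card + IA.card * EB.card := by
      have := (Finset.card_image_le
        (f := fun q : ℤ × ℤ => ((P.ray ((L : ℤ) * q.1).toNat, (h : ℤ) * q.2) : S.E))).trans
        (Finset.card_union_le (EA ×ˢ IB) (IA ×ˢ EB))
      rw [Finset.card_product, Finset.card_product] at this
      exact_mod_cast this
    have h1 : (EA.card : ℝ) * IB.card ≤ 2 * IB.card := by gcongr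
    have h2 : (IA.card : ℝ) * EB.card ≤ IA.card * 2 := by gcongr
    nlinarith
  · rintro u v hu hv ⟨m, hm⟩ h₁ h₂
    rw [S.mem_ball_iff (Nat.cast_nonneg R), Nat.cast_le, ← hbdef, ← hZ] at hu hv
    have hdm : S.dG x.1 v.1 = Nat.dist n₀ m := by rw [hn₀, hm, P.geodesic]
    have hdR : S.dG x.1 v.1 ≤ R + 1 := (S.dG_triangle _ u.1 _).trans (add_le_add hu.1 h₁)
    rw [hdm] at hdR hv
    unfold Nat.dist at hdR hv
    have hLz : (0 : ℤ) < L := by omega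
    have hhz : (0 : ℤ) < h := by omega
    have hIAm : (m : ℤ) / L ∈ IA := Finset.mem_Icc.2
      ⟨Int.ediv_le_ediv hLz (by omega), Int.ediv_le_ediv hLz (by omega)⟩
    have hIBm : v.2 / (h : ℤ) ∈ IB := Finset.mem_Icc.2
      ⟨Int.ediv_le_ediv hhz (by omega), Int.ediv_le_ediv hhz (by omega)⟩
    have hmem : ((m : ℤ) / L, v.2 / (h : ℤ)) ∈ EA ×ˢ IB ∪ IA ×ˢ EB := by
      rw [Finset.mem_union, Finset.mem_product, Finset.mem_product]
      by_cases hG : n₀ - m + (m - n₀) ≤ R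
      · have hz : ¬ (x.2 - v.2).natAbs ≤ Z := fun h => hv ⟨hG, h⟩
        refine Or.inr ⟨hIAm, ?_⟩
        rcases (show v.2 = x.2 - ((Z : ℤ) + 1) ∨ v.2 = x.2 + ((Z : ℤ) + 1) by omega) with e | e <;>
          simp [EB, e]
      · refine Or.inl ⟨?_, hIBm⟩
        rcases (show (m : ℤ) = n₀ - ((R : ℤ) + 1) ∨ (m : ℤ) = n₀ + ((R : ℤ) + 1) by omega)
          with e | e <;> simp [EA, e]
    refine ⟨_, Finset.mem_image_of_mem _ hmem, ⟨_, rfl⟩, ?_⟩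
    refine (S.mem_ball_iff (Nat.cast_nonneg L)).2 ⟨?_, ?_⟩
    · rw [hm, P.geodesic, Nat.cast_le]
      have e1 := Int.mul_ediv_add_emod (m : ℤ) L
      have e2 := Int.emod_nonneg (m : ℤ) hLz.ne'
      have e3 := Int.emod_lt_of_pos (m : ℤ) hLz
      have e4 : (0 : ℤ) ≤ (L : ℤ) * ((m : ℤ) / L) := by positivity
      unfold Nat.dist
      dsimp only
      omega
    · rw [← hbdef, ← hh]
      have e1 := Int.mul_ediv_add_emod v.2 h
      have e2 := Int.emod_nonneg v.2 hhz.ne'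
      have e3 := Int.emod_lt_of_pos v.2 hhz
      dsimp only
      omega

/-- A long `*`-crossing meets the net of an intermediate shell at a point around which a
`*`-crossing at scale `L` occurs. -/
lemma exists_crossing_near_shell (S : GraphSetup) (P : S.HalfPlane) {x : S.E} {L R M : ℕ}
    (hL : 1 ≤ L) {T : Finset S.E}
    (hT : ∀ u v : S.E, u ∈ S.ball x R → v ∉ S.ball x R → v ∈ P.carrier → S.dG u.1 v.1 ≤ 1 →
        (u.2 - v.2).natAbs ≤ 1 → ∃ x' ∈ T, x' ∈ P.carrier ∧ S.dE x' v ≤ L)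
    (hMR : M ≤ R) (hRM : R + 5 * L ≤ 2 * M) {C : Set S.E}
    (h : S.StarConnectsIn P C (S.ball x M) (S.intBoundary (S.ball x (2 * M)))) :
    ∃ x' ∈ T, R - L < S.dE x x' ∧ S.dE x x' ≤ R + 1 + L ∧ x' ∈ P.carrier ∧
      S.StarConnectsIn P C (S.ball x' L) (S.intBoundary (S.ball x' (2 * L))) := by
  obtain ⟨n, p, hp, hstep, h0, hn⟩ := h
  have hL' : (1 : ℝ) ≤ L := by exact_mod_cast hL
  have hMR' : (M : ℝ) ≤ R := by exact_mod_cast hMR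
  have hRM' : (R : ℝ) + 5 * L ≤ 2 * M := by exact_mod_cast hRM
  have hfar := S.lt_dE_add_one_of_mem_intBoundary hn
  have h0' : p 0 ∈ S.ball x R := le_trans (show S.dE x (p 0) ≤ M from h0) hMR'
  have hn' : p n ∉ S.ball x R := fun h => by
    have : S.dE x (p n) ≤ R := h
    linarith
  obtain ⟨i, hi, hin, hout⟩ := exists_first_exit h0' hn'
  have hs := hstep i hi
  obtain ⟨x', hx'T, hx'P, hx'⟩ := hT _ _ (hin i le_rfl) hout (hp (i + 1) hi).2 hs.2.1 hs.2.2
  have hi1 : S.dE x (p i) ≤ R := hin i le_rfl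
  have hi2 : (R : ℝ) < S.dE x (p (i + 1)) := not_le.1 hout
  have hi3 := S.dE_le_one hs.2.1 hs.2.2
  have t1 := S.dE_triangle x (p i) (p (i + 1))
  have t2 := S.dE_triangle x (p (i + 1)) x'
  have t3 := S.dE_triangle x x' (p (i + 1))
  have t4 := S.dE_triangle x x' (p n)
  rw [S.dE_comm (p (i + 1)) x'] at t2
  have hend : p n ∉ S.ball x' (2 * L) := fun h => by
    have : S.dE x' (p n) ≤ 2 * L := h
    linarith
  refine ⟨x', hx'T, by linarith, by linarith, hx'P, ?_⟩
  refine StarConnectsIn.mono inter_subset_left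
    (S.starConnectsIn_of_exit P (Nat.cast_nonneg L) (n := n - (i + 1)) (p := fun j => p (i + 1 + j))
      (fun j hj => hp _ (by omega)) (fun j hj => hstep _ (by omega)) hx' ?_)
  rwa [Nat.add_sub_cancel' (show i + 1 ≤ n from hi)]

end GraphSetup

open GraphSetup

/-- Proposition 3.2 (3.12): the family `ℬ = (B_{x,L,𝒫})`, where `B_{x,L,𝒫}` is the event
that `B(x,L)` is connected to `∂_int B(x,2L)` by a `*`-path in `𝒫` on which the
configuration equals `1` (and `B_{x,L,𝒫} = ∅` if `x ∉ 𝒫`), is a family of increasing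
events that cascades uniformly in `𝒫` with complexity at most `β/2`. -/
theorem stmt11 (S : GraphSetup) (W : WalkLaw S) (cg cg' : ℝ) (hG : W.GreenBounds cg cg') :
    (∀ (P : S.HalfPlane) (x : S.E) (L : ℕ), S.IncreasingEvent
        {C : Set S.E | x ∈ P.carrier ∧
          S.StarConnectsIn P C (S.ball x L) (S.intBoundary (S.ball x (2 * L)))}) ∧
    ∃ c : ℝ, 0 < c ∧ ∀ P : S.HalfPlane,
      S.CascadesLe
        (fun x L =>
          {C : Set S.E | x ∈ P.carrier ∧
            S.StarConnectsIn P C (S.ball x L) (S.intBoundary (S.ball x (2 * L)))})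
        (S.β / 2) c := by
  refine ⟨fun P x L C C' hCC hC => ⟨hC.1, hC.2.mono hCC⟩,
    2 * (16 * 2 ^ (S.β / 2) + 20), by positivity, fun P =>
    ⟨fun x L _ => S.dependsOn_starCrossing P x L, fun l x L hL hl hdvd => ?_⟩⟩
  by_cases hx : x ∈ P.carrier
  swap
  · exact ⟨∅, by simp, by simp; positivity, fun C hC => absurd hC.1 hx⟩
  obtain ⟨k, rfl⟩ := hdvd
  have hk : 1 ≤ k := by omega
  have hkL : L ≤ k * L := Nat.le_mul_of_pos_left L hk
  have hl1 : 1 ≤ 100 * k := hl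
  obtain ⟨T₁, hc₁, hT₁⟩ := S.exists_shell_net P hx (R := 125 * (k * L)) hL hl1 (by omega)
    (by rw [show 2 * (100 * k) * L = 200 * (k * L) by ring]; omega)
  obtain ⟨T₂, hc₂, hT₂⟩ := S.exists_shell_net P hx (R := 175 * (k * L)) hL hl1 (by omega)
    (by rw [show 2 * (100 * k) * L = 200 * (k * L) by ring]; omega)
  have hL' : (1 : ℝ) ≤ L := by exact_mod_cast hL
  have hkL' : (L : ℝ) ≤ k * L := by exact_mod_cast hkL
  refine ⟨(T₁ ∪ T₂).filter (· ∈ S.ball x (9 * (100 * k : ℕ) * L)), ?_, ?_, ?_⟩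
  · intro w hw
    exact (Finset.mem_filter.1 hw).2
  · have h1 : ((((T₁ ∪ T₂).filter (· ∈ S.ball x (9 * (100 * k : ℕ) * L))).card : ℕ) : ℝ)
        ≤ T₁.card + T₂.card := by
      exact_mod_cast (Finset.card_filter_le _ _).trans (Finset.card_union_le _ _)
    linarith
  · rintro C ⟨-, hC⟩
    have hC' : S.StarConnectsIn P C (S.ball x (100 * k * L : ℕ))
      (S.intBoundary (S.ball x (2 * (100 * k * L : ℕ)))) := hC
    obtain ⟨x₁, hx₁T, hlo₁, hhi₁, hx₁P, hC₁⟩ := S.exists_crossing_near_shell P hL hT₁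
      (M := 100 * k * L) (by rw [mul_assoc]; omega) (by rw [mul_assoc]; omega) hC'
    obtain ⟨x₂, hx₂T, hlo₂, hhi₂, hx₂P, hC₂⟩ := S.exists_crossing_near_shell P hL hT₂
      (M := 100 * k * L) (by rw [mul_assoc]; omega) (by rw [mul_assoc]; omega) hC'
    push_cast at hlo₁ hhi₁ hlo₂ hhi₂
    have hb : ∀ w : S.E, S.dE x w ≤ 175 * (k * L : ℝ) + 1 + L →
        w ∈ S.ball x (9 * (100 * k : ℕ) * L) := by
      intro w hw
      refine hw.trans ?_
      push_cast
      nlinarith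
    have ht := S.dE_triangle x x₁ x₂
    simp only [mem_iUnion]
    refine ⟨x₁, Finset.mem_filter.2 ⟨Finset.mem_union_left _ hx₁T, hb _ (by linarith)⟩,
      x₂, Finset.mem_filter.2 ⟨Finset.mem_union_right _ hx₂T, hb _ (by linarith)⟩, ?_,
      ⟨hx₁P, hC₁⟩, ⟨hx₂P, hC₂⟩⟩
    push_cast
    linarith
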